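/- For all integers m, k ≥ 2, ESO(m,k) < ESO(m+1,k) and ESO(m,k) < ESO(m,k+1); that is, ESO(m,k) is strictly increasing in each of m and k on the range m, k ≥ 2. -/

import Mathlib

open Set

/-- A point in the plane. -/
abbrev Pt : Type := ℝ × ℝ

/-- The point set `P` contains an `n`-up-run: `n` points with strictly increasing
`x`-coordinates and nondecreasing `y`-coordinates. -/
def HasUpRun (P : Set Pt) (n : ℕ) : Prop :=
  ∃ f : Fin n → Pt, (∀ i, f i ∈ P) ∧
    StrictMono (fun i => (f i).1) ∧ Monotone (fun i => (f i).2)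

/-- The point set `P` contains an `n`-down-run: `n` points with strictly increasing
`x`-coordinates and strictly decreasing `y`-coordinates. -/
def HasDownRun (P : Set Pt) (n : ℕ) : Prop :=
  ∃ f : Fin n → Pt, (∀ i, f i ∈ P) ∧
    StrictMono (fun i => (f i).1) ∧ StrictAnti (fun i => (f i).2)

/-- A strategy for player A: from the list of previously played points, choose
an x-coordinate. -/
abbrev AStrat : Type := List Pt → ℝ

/-- A strategy for player B: from the list of previously played points and the new
x-coordinate, choose a y-coordinate. -/
abbrev BStrat : Type := List Pt → ℝ → ℝ

/-- Validity of a strategy for player A in either game: the chosen x-coordinate lies in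
`(0,1)` and is distinct from all previously played x-coordinates. -/
def AValid (sA : AStrat) : Prop :=
  ∀ h : List Pt, sA h ∈ Ioo (0:ℝ) 1 ∧ ∀ p ∈ h, sA h ≠ p.1

/-- Validity of a strategy for player B in the game `A_{m,k}`: the chosen y-coordinate
lies in `(0,1)` and is distinct from all previously played y-coordinates. -/
def BValid (sB : BStrat) : Prop :=
  ∀ (h : List Pt) (x : ℝ), sB h x ∈ Ioo (0:ℝ) 1 ∧ ∀ p ∈ h, sB h x ≠ p.2

/-- The list of points played in the first `n` turns when A plays `sA` and B plays `sB`. -/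
def hist (sA : AStrat) (sB : BStrat) : ℕ → List Pt
  | 0 => []
  | n + 1 =>
      let h := hist sA sB n
      h ++ [(sA h, sB h (sA h))]

/-- The set of points played in the first `N` turns. -/
def played (sA : AStrat) (sB : BStrat) (N : ℕ) : Set Pt :=
  {p | p ∈ hist sA sB N}

/-- In the game `A_{m,k}`, strategy `sA` of player A is valid and guarantees an
`m`-up-run or a `k`-down-run among the first `N` points, against every valid
strategy of player B. -/
def AWinsBy (m k N : ℕ) (sA : AStrat) : Prop :=
  AValid sA ∧ ∀ sB : BStrat, BValid sB →
    HasUpRun (played sA sB N) m ∨ HasDownRun (played sA sB N) k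

/-- The Erdős–Szekeres on-line number `ESO(m,k)`: the least `N` such that player A
has a strategy forcing an `m`-up-run or a `k`-down-run within `N` turns. -/
noncomputable def ESO (m k : ℕ) : ℕ := sInf {N | ∃ sA : AStrat, AWinsBy m k N sA}

/-- Validity of a strategy for player B in the tier game `B_{m,k}`: the chosen
y-coordinate is an integer in `{1, …, k-1}` (repetitions allowed). -/
def BTierValid (k : ℕ) (sB : BStrat) : Prop :=
  ∀ (h : List Pt) (x : ℝ), ∃ j : ℕ, 1 ≤ j ∧ j ≤ k - 1 ∧ sB h x = (j : ℝ)

/-- In the tier game `B_{m,k}`, strategy `sA` of player A is valid and guarantees an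
`m`-up-run among the first `N` points, against every valid strategy of player B. -/
def AWinsTierBy (m k N : ℕ) (sA : AStrat) : Prop :=
  AValid sA ∧ ∀ sB : BStrat, BTierValid k sB → HasUpRun (played sA sB N) m

/-- `B(m,k)`: the least `N` such that player A has a strategy forcing an `m`-up-run
within `N` turns of the tier game `B_{m,k}`. -/
noncomputable def BNum (m k : ℕ) : ℕ := sInf {N | ∃ sA : AStrat, AWinsTierBy m k N sA}

/-- The set `P` contains `n` points forming a list whose pairs, in order, are related by `r`. -/
def HasRun (r : Pt → Pt → Prop) (P : Set Pt) (n : ℕ) : Prop :=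
  ∃ l : List Pt, l.Pairwise r ∧ (∀ p ∈ l, p ∈ P) ∧ l.length = n

/-- `q` lies to the right of `p` and not below it. -/
def UpRel (p q : Pt) : Prop := p.1 < q.1 ∧ p.2 ≤ q.2

/-- `q` lies to the right of `p` and below it. -/
def DownRel (p q : Pt) : Prop := p.1 < q.1 ∧ q.2 < p.2

theorem hasUpRun_iff_hasRun (P : Set Pt) (n : ℕ) : HasUpRun P n ↔ HasRun UpRel P n := by
  constructor
  · rintro ⟨f, hP, hx, hy⟩
    refine ⟨List.ofFn f, ?_, ?_, by simp⟩
    · rw [List.pairwise_ofFn]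
      exact fun i j hij => ⟨hx hij, hy hij.le⟩
    · simpa [List.mem_ofFn] using hP
  · rintro ⟨l, hl, hP, rfl⟩
    rw [List.pairwise_iff_get] at hl
    refine ⟨l.get, fun i => hP _ (l.get_mem i), fun i j hij => (hl i j hij).1, ?_⟩
    exact monotone_iff_forall_lt.2 fun i j hij => (hl i j hij).2

theorem hasDownRun_iff_hasRun (P : Set Pt) (n : ℕ) : HasDownRun P n ↔ HasRun DownRel P n := by
  constructor
  · rintro ⟨f, hP, hx, hy⟩
    refine ⟨List.ofFn f, ?_, ?_, by simp⟩
    · rw [List.pairwise_ofFn]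
      exact fun i j hij => ⟨hx hij, hy hij⟩
    · simpa [List.mem_ofFn] using hP
  · rintro ⟨l, hl, hP, rfl⟩
    rw [List.pairwise_iff_get] at hl
    exact ⟨l.get, fun i => hP _ (l.get_mem i), fun i j hij => (hl i j hij).1,
      fun i j hij => (hl i j hij).2⟩

theorem nodup_of_pairwise_lt_fst {r : Pt → Pt → Prop} (hr : ∀ p q, r p q → p.1 < q.1)
    {l : List Pt} (hl : l.Pairwise r) : l.Nodup :=
  hl.imp fun {p q} h e => (hr p q h).ne (congrArg Prod.fst e)

/-- Removing one point shortens the longest run by at most one. -/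
theorem HasRun.of_insert {r : Pt → Pt → Prop} (hr : ∀ p q, r p q → p.1 < q.1)
    {P : Set Pt} {z : Pt} {n : ℕ} (h : HasRun r (insert z P) (n + 1)) : HasRun r P n := by
  obtain ⟨l, hl, hP, hn⟩ := h
  have hnd := nodup_of_pairwise_lt_fst hr hl
  by_cases hz : z ∈ l
  · refine ⟨l.erase z, hl.sublist List.erase_sublist, fun p hp => ?_, ?_⟩
    · rw [hnd.mem_erase_iff] at hp
      exact (hP p hp.2).resolve_left hp.1
    · rw [List.length_erase_of_mem hz, hn, Nat.add_sub_cancel]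
  · refine ⟨l.tail, hl.sublist l.tail_sublist, fun p hp => ?_, by simp [hn]⟩
    have hpl := List.mem_of_mem_tail hp
    exact (hP p hpl).resolve_left fun e => hz (e ▸ hpl)

theorem exists_between_finite {Q : Set ℝ} (hQ : Q.Finite) {c : ℝ} (hc : 0 < c) :
    ∃ y, 0 < y ∧ y < c ∧ ∀ q ∈ Q, q < c → q < y := by
  obtain ⟨a, ha, hmax⟩ := Set.exists_max_image (insert 0 (Q ∩ Iio c)) id
    ((hQ.inter_of_left _).insert 0) ⟨0, mem_insert _ _⟩
  have hac : a < c := by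
    rcases ha with rfl | ha
    · exact hc
    · exact ha.2
  obtain ⟨y, hay, hyc⟩ := exists_between hac
  exact ⟨y, (hmax 0 (mem_insert _ _)).trans_lt hay, hyc, fun q hq hqc =>
    (hmax q (mem_insert_of_mem _ ⟨hq, hqc⟩)).trans_lt hay⟩

/-- A point with a prescribed new `x`-coordinate can be added to a finite set without creating
a `k`-down-run. -/
theorem exists_insert_not_hasRun_downRel {P : Set Pt} (hfin : P.Finite)
    (hP : ∀ p ∈ P, p.2 ∈ Ioo (0 : ℝ) 1) (hinj : InjOn Prod.snd P) {k : ℕ} (hk : 2 ≤ k)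
    (hrun : ¬ HasRun DownRel P k) (x : ℝ) :
    ∃ y ∈ Ioo (0 : ℝ) 1, (∀ p ∈ P, y ≠ p.2) ∧ ¬ HasRun DownRel (insert (x, y) P) k := by
  obtain ⟨k, rfl⟩ := Nat.exists_eq_add_of_le' hk
  let S : Set Pt := {p ∈ P | x < p.1 ∧
    ∃ l : List Pt, (p :: l).Pairwise DownRel ∧ (∀ q ∈ l, q ∈ P) ∧ l.length = k}
  have hc : ∃ c : ℝ, 0 < c ∧ c ≤ 1 ∧ (∀ q ∈ S, c ≤ q.2) ∧ ∀ a ∈ P, a.1 < x → a.2 < c := by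
    rcases S.eq_empty_or_nonempty with hS | hS
    · exact ⟨1, one_pos, le_rfl, by simp [hS], fun a ha _ => (hP a ha).2⟩
    · obtain ⟨p, hp, hmin⟩ := Set.exists_min_image S Prod.snd (hfin.subset fun _ h => h.1) hS
      refine ⟨p.2, (hP p hp.1).1, (hP p hp.1).2.le, hmin, fun a ha hax => ?_⟩
      obtain ⟨hpP, hxp, l, hl, hlP, hlen⟩ := hp
      by_contra! hle
      have hne : p.2 ≠ a.2 := fun e => (hax.trans hxp).ne (by rw [hinj hpP ha e])
      have hap : DownRel a p := ⟨hax.trans hxp, lt_of_le_of_ne hle hne⟩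
      refine hrun ⟨a :: p :: l, List.pairwise_cons.2 ⟨?_, hl⟩, ?_, by simp [hlen]⟩
      · intro q hq
        rcases List.mem_cons.1 hq with rfl | hq
        · exact hap
        · have hpq := List.rel_of_pairwise_cons hl hq
          exact ⟨hap.1.trans hpq.1, hpq.2.trans hap.2⟩
      · simpa [ha, hpP] using hlP
  obtain ⟨c, hc0, hc1, hcS, hcP⟩ := hc
  obtain ⟨y, hy0, hyc, hy⟩ := exists_between_finite (hfin.image Prod.snd) hc0
  have hy' : ∀ p ∈ P, p.2 < c → p.2 < y := fun p hp => hy _ (mem_image_of_mem _ hp)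
  refine ⟨y, ⟨hy0, hyc.trans_le hc1⟩, fun p hp e => (hy' p hp (e ▸ hyc)).ne e.symm, ?_⟩
  rintro ⟨l, hl, hlP, hlen⟩
  by_cases hz : (x, y) ∈ l
  · obtain ⟨l₁, l₂, rfl⟩ := List.append_of_mem hz
    have hP' : ∀ p ∈ l₁ ++ (x, y) :: l₂, p.1 ≠ x → p ∈ P := fun p hp hpx =>
      (hlP p hp).resolve_left fun e => hpx (by rw [e])
    rw [List.pairwise_append] at hl
    obtain ⟨-, hl₂, hl₁⟩ := hl
    cases l₁ with
    | cons a l₁ =>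
      have ha : DownRel a (x, y) := hl₁ a (by simp) _ (by simp)
      have haP := hP' a (by simp) ha.1.ne
      exact lt_asymm ha.2 (hy' a haP (hcP a haP ha.1))
    | nil =>
      have hxl : ∀ q ∈ l₂, DownRel (x, y) q := fun q hq => List.rel_of_pairwise_cons hl₂ hq
      have hlP₂ : ∀ q ∈ l₂, q ∈ P := fun q hq => hP' q (by simp [hq]) (hxl q hq).1.ne'
      cases l₂ with
      | nil => simp at hlen
      | cons q l₂ =>
        have hqS : q ∈ S := ⟨hlP₂ q (by simp), (hxl q (by simp)).1, l₂, hl₂.of_cons,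
          fun p hp => hlP₂ p (by simp [hp]), by simpa using hlen⟩
        exact ((hcS q hqS).trans_lt (hxl q (by simp)).2).not_gt hyc
  · exact hrun ⟨l, hl, fun p hp => (hlP p hp).resolve_left fun e => hz (e ▸ hp), hlen⟩

theorem HasRun.image {r s : Pt → Pt → Prop} {P Q : Set Pt} {n : ℕ} (f : Pt → Pt)
    (hf : MapsTo f P Q) (hrs : ∀ p ∈ P, ∀ q ∈ P, r p q → s (f p) (f q)) (h : HasRun r P n) :
    HasRun s Q n := by
  obtain ⟨l, hl, hP, hn⟩ := h
  refine ⟨l.map f, List.pairwise_map.2 ?_, ?_, by simpa using hn⟩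
  · exact hl.imp_of_mem fun {p q} hp hq => hrs p (hP p hp) q (hP q hq)
  · simp only [List.mem_map]
    rintro _ ⟨p, hp, rfl⟩
    exact hf (hP p hp)

/-- A point with a prescribed new `x`-coordinate can be added to a finite set without creating
an `m`-up-run. -/
theorem exists_insert_not_hasRun_upRel {P : Set Pt} (hfin : P.Finite)
    (hP : ∀ p ∈ P, p.2 ∈ Ioo (0 : ℝ) 1) (hinj : InjOn Prod.snd P) {m : ℕ} (hm : 2 ≤ m)
    (hrun : ¬ HasRun UpRel P m) (x : ℝ) :
    ∃ y ∈ Ioo (0 : ℝ) 1, (∀ p ∈ P, y ≠ p.2) ∧ ¬ HasRun UpRel (insert (x, y) P) m := by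
  let f : Pt → Pt := fun p => (p.1, 1 - p.2)
  have hff : ∀ p, f (f p) = p := fun p => by simp [f]
  have hfP : MapsTo f (f '' P) P := by
    rintro _ ⟨p, hp, rfl⟩
    rwa [hff]
  obtain ⟨y, ⟨hy0, hy1⟩, hy, hrun'⟩ := exists_insert_not_hasRun_downRel (P := f '' P)
    (hfin.image f) (by
      rintro _ ⟨p, hp, rfl⟩
      exact ⟨sub_pos.2 (hP p hp).2, sub_lt_self _ (hP p hp).1⟩) (by
      rintro _ ⟨p, hp, rfl⟩ _ ⟨q, hq, rfl⟩ e
      exact congrArg f (hinj hp hq (sub_right_injective e))) hm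
    (fun h => hrun (h.image f hfP fun p _ q _ hpq =>
      ⟨hpq.1, (sub_lt_sub_left hpq.2 1).le⟩)) x
  have hne : ∀ p ∈ P, 1 - y ≠ p.2 := fun p hp e =>
    hy (f p) (mem_image_of_mem f hp) (by simp only [f]; linarith)
  refine ⟨1 - y, ⟨sub_pos.2 hy1, sub_lt_self _ hy0⟩, hne, fun h => hrun' ?_⟩
  refine h.image f ?_ ?_
  · rintro p (rfl | hp)
    · left
      simp [f]
    · exact Or.inr (mem_image_of_mem f hp)
  · have hinj' : InjOn Prod.snd (insert (x, 1 - y) P) := by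
      rintro p (rfl | hp) q (rfl | hq) e
      · rfl
      · exact absurd e (hne q hq)
      · exact absurd e.symm (hne p hp)
      · exact hinj hp hq e
    intro p hp q hq hpq
    have hlt : p.2 < q.2 := lt_of_le_of_ne hpq.2 fun e =>
      hpq.1.ne (by rw [hinj' hp hq e])
    exact ⟨hpq.1, sub_lt_sub_left hlt 1⟩

theorem hist_length (sA : AStrat) (sB : BStrat) (n : ℕ) : (hist sA sB n).length = n := by
  induction n with
  | zero => rfl
  | succ n ih => simp [hist, ih]

theorem played_succ (sA : AStrat) (sB : BStrat) (n : ℕ) :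
    played sA sB (n + 1) =
      insert (sA (hist sA sB n), sB (hist sA sB n) (sA (hist sA sB n))) (played sA sB n) := by
  ext p
  simp [played, hist, or_comm]

theorem played_finite (sA : AStrat) (sB : BStrat) (n : ℕ) : (played sA sB n).Finite :=
  List.finite_toSet _

theorem snd_mem_of_mem_played {sA : AStrat} {sB : BStrat} (hB : BValid sB) (n : ℕ) :
    ∀ p ∈ played sA sB n, p.2 ∈ Ioo (0 : ℝ) 1 := by
  induction n with
  | zero => simp [played, hist]
  | succ n ih =>
    rw [played_succ]
    rintro p (rfl | hp)
    · exact (hB _ _).1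
    · exact ih p hp

theorem injOn_snd_played {sA : AStrat} {sB : BStrat} (hB : BValid sB) (n : ℕ) :
    InjOn Prod.snd (played sA sB n) := by
  induction n with
  | zero => simp [played, hist, InjOn]
  | succ n ih =>
    rw [played_succ]
    rintro p (rfl | hp) q (rfl | hq) e
    · rfl
    · exact absurd e ((hB _ _).2 q hq)
    · exact absurd e.symm ((hB _ _).2 p hp)
    · exact ih hp hq e

open Classical in
/-- Player B can follow `sB` for `N` turns and then answer with any admissible `y`. -/
theorem exists_bValid_played_succ (sA : AStrat) {sB : BStrat} (hB : BValid sB) (N : ℕ) {y : ℝ}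
    (hy : y ∈ Ioo (0 : ℝ) 1) (hne : ∀ p ∈ played sA sB N, y ≠ p.2) :
    ∃ sB' : BStrat, BValid sB' ∧
      played sA sB' (N + 1) = insert (sA (hist sA sB N), y) (played sA sB N) := by
  let sB' : BStrat := fun h x => if h = hist sA sB N then y else sB h x
  have hhist : ∀ n ≤ N, hist sA sB' n = hist sA sB n := by
    intro n hn
    induction n with
    | zero => rfl
    | succ n ih =>
      have hne : hist sA sB n ≠ hist sA sB N := fun e => by
        have := congrArg List.length e
        rw [hist_length, hist_length] at this
        omega
      simp [hist, ih (by omega), sB', hne]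
  refine ⟨sB', fun h x => ?_, ?_⟩
  · by_cases hh : h = hist sA sB N
    · simp only [sB', if_pos hh]
      subst hh
      exact ⟨hy, hne⟩
    · simpa only [sB', if_neg hh] using hB h x
  · rw [played_succ, played, hhist N le_rfl]
    simp [sB', played]

theorem AWinsBy.of_succ_up {m k N : ℕ} (hk : 2 ≤ k) {sA : AStrat}
    (h : AWinsBy (m + 1) k (N + 1) sA) : AWinsBy m k N sA := by
  refine ⟨h.1, fun sB hB => ?_⟩
  by_contra! hcon
  rw [hasUpRun_iff_hasRun, hasDownRun_iff_hasRun] at hcon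
  obtain ⟨y, hy, hne, hrun⟩ := exists_insert_not_hasRun_downRel (played_finite sA sB N)
    (snd_mem_of_mem_played hB N) (injOn_snd_played hB N) hk hcon.2 (sA (hist sA sB N))
  obtain ⟨sB', hB', hplayed⟩ := exists_bValid_played_succ sA hB N hy hne
  have hwin := h.2 sB' hB'
  rw [hplayed, hasUpRun_iff_hasRun, hasDownRun_iff_hasRun] at hwin
  exact hwin.elim (fun hup => hcon.1 (hup.of_insert fun _ _ h => h.1)) hrun

theorem AWinsBy.of_succ_down {m k N : ℕ} (hm : 2 ≤ m) {sA : AStrat}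
    (h : AWinsBy m (k + 1) (N + 1) sA) : AWinsBy m k N sA := by
  refine ⟨h.1, fun sB hB => ?_⟩
  by_contra! hcon
  rw [hasUpRun_iff_hasRun, hasDownRun_iff_hasRun] at hcon
  obtain ⟨y, hy, hne, hrun⟩ := exists_insert_not_hasRun_upRel (played_finite sA sB N)
    (snd_mem_of_mem_played hB N) (injOn_snd_played hB N) hm hcon.1 (sA (hist sA sB N))
  obtain ⟨sB', hB', hplayed⟩ := exists_bValid_played_succ sA hB N hy hne
  have hwin := h.2 sB' hB'
  rw [hplayed, hasUpRun_iff_hasRun, hasDownRun_iff_hasRun] at hwin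
  exact hwin.elim hrun fun hdown => hcon.2 (hdown.of_insert fun _ _ h => h.1)

theorem exists_gt_of_lt_one (f : Pt → ℝ) (h : List Pt) :
    ∃ y : ℝ, 0 < y ∧ y < 1 ∧ ∀ p ∈ h, f p < 1 → f p < y := by
  obtain ⟨y, h0, h1, hy⟩ := exists_between_finite (h.finite_toSet.image f) one_pos
  exact ⟨y, h0, h1, fun p hp => hy (f p) (mem_image_of_mem _ hp)⟩

/-- A weak form of the Erdős–Szekeres theorem. -/
theorem hasRun_upRel_or_hasRun_downRel (n : ℕ) : ∀ (a b : ℕ), a + b = n →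
    ∀ l : List Pt, l.Pairwise (fun p q => p.1 < q.1) → 2 ^ n ≤ l.length →
      HasRun UpRel {p | p ∈ l} a ∨ HasRun DownRel {p | p ∈ l} b := by
  induction n with
  | zero =>
    intro a b hab l _ _
    obtain rfl : a = 0 := by omega
    exact Or.inl ⟨[], by simp⟩
  | succ n ih =>
    intro a b hab l hl hlen
    rcases a with _ | a
    · exact Or.inl ⟨[], by simp⟩
    rcases b with _ | b
    · exact Or.inr ⟨[], by simp⟩
    rcases l with _ | ⟨p, l⟩
    · simp at hlen
    rw [List.pairwise_cons] at hl
    have hsplit := l.length_eq_length_filter_add fun q => decide (p.2 ≤ q.2)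
    rw [List.length_cons, pow_succ] at hlen
    rcases le_or_gt (2 ^ n) (l.filter fun q => decide (p.2 ≤ q.2)).length with hup | hup
    · rcases ih a (b + 1) (by omega) _ (hl.2.filter _) hup with ⟨t, ht, htl, htn⟩ | ⟨t, ht, htl, htn⟩
      · refine Or.inl ⟨p :: t, List.pairwise_cons.2 ⟨fun q hq => ?_, ht⟩, ?_, by simp [htn]⟩
        · have := htl q hq
          simp only [mem_ofPred_eq, List.mem_filter, decide_eq_true_eq] at this
          exact ⟨hl.1 q this.1, this.2⟩
        · intro q hq
          rcases List.mem_cons.1 hq with rfl | hq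
          · simp
          · exact List.mem_cons_of_mem _ (List.mem_of_mem_filter (htl q hq))
      · exact Or.inr ⟨t, ht, fun q hq =>
          List.mem_cons_of_mem _ (List.mem_of_mem_filter (htl q hq)), htn⟩
    · rcases ih (a + 1) b (by omega) _ (hl.2.filter fun q => !decide (p.2 ≤ q.2)) (by omega) with
        ⟨t, ht, htl, htn⟩ | ⟨t, ht, htl, htn⟩
      · exact Or.inl ⟨t, ht, fun q hq =>
          List.mem_cons_of_mem _ (List.mem_of_mem_filter (htl q hq)), htn⟩
      · refine Or.inr ⟨p :: t, List.pairwise_cons.2 ⟨fun q hq => ?_, ht⟩, ?_, by simp [htn]⟩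
        · have := htl q hq
          simp only [mem_ofPred_eq, List.mem_filter, Bool.not_eq_true', decide_eq_false_iff_not,
            not_le] at this
          exact ⟨hl.1 q this.1, this.2⟩
        · intro q hq
          rcases List.mem_cons.1 hq with rfl | hq
          · simp
          · exact List.mem_cons_of_mem _ (List.mem_of_mem_filter (htl q hq))

theorem exists_aWinsBy (m k : ℕ) : ∃ N sA, AWinsBy m k N sA := by
  choose sA h0 h1 hsA using exists_gt_of_lt_one Prod.fst
  refine ⟨2 ^ (m + k), sA, fun h => ⟨⟨h0 h, h1 h⟩, fun p hp e => ?_⟩, fun sB _ => ?_⟩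
  · exact (hsA h p hp (e ▸ h1 h)).ne e.symm
  · have hsorted : ∀ n, (hist sA sB n).Pairwise (fun p q => p.1 < q.1) ∧
        ∀ p ∈ hist sA sB n, p.1 < 1 := by
      intro n
      induction n with
      | zero => simp [hist]
      | succ n ih =>
        refine ⟨List.pairwise_append.2 ⟨ih.1, by simp, fun p hp q hq => ?_⟩, fun p hp => ?_⟩
        · rw [List.mem_singleton.1 hq]
          exact hsA _ p hp (ih.2 p hp)
        · rcases List.mem_append.1 hp with hp | hp
          · exact ih.2 p hp
          · rw [List.mem_singleton.1 hp]
            exact h1 _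
    rw [hasUpRun_iff_hasRun, hasDownRun_iff_hasRun]
    exact hasRun_upRel_or_hasRun_downRel _ m k rfl _ (hsorted _).1 (hist_length _ _ _).ge

theorem ESO_spec (m k : ℕ) : ∃ sA, AWinsBy m k (ESO m k) sA :=
  Nat.sInf_mem (s := {N | ∃ sA : AStrat, AWinsBy m k N sA}) (exists_aWinsBy m k)

theorem ESO_pos {m k : ℕ} (hm : 0 < m) (hk : 0 < k) : 0 < ESO m k := by
  by_contra! h0
  obtain ⟨sA, -, hwin⟩ := ESO_spec m k
  choose y hy0 hy1 hy using exists_gt_of_lt_one Prod.snd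
  have hB : BValid fun h _ => y h := fun h _ => ⟨⟨hy0 h, hy1 h⟩, fun p hp e =>
    (hy h p hp (e ▸ hy1 h)).ne e.symm⟩
  have := hwin _ hB
  rw [Nat.le_zero.1 h0] at this
  rcases this with ⟨f, hf, -⟩ | ⟨f, hf, -⟩
  · simpa [played, hist] using hf ⟨0, hm⟩
  · simpa [played, hist] using hf ⟨0, hk⟩

theorem ESO_strictMono (m k : ℕ) (hm : 2 ≤ m) (hk : 2 ≤ k) :
    ESO m k < ESO (m + 1) k ∧ ESO m k < ESO m (k + 1) := by
  constructor
  · obtain ⟨sA, hwin⟩ := ESO_spec (m + 1) k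
    obtain ⟨N, hN⟩ := Nat.exists_eq_add_one.2 (ESO_pos (m := m + 1) (k := k) (by omega) (by omega))
    rw [hN] at hwin ⊢
    exact Nat.lt_succ_of_le (Nat.sInf_le ⟨sA, hwin.of_succ_up hk⟩)
  · obtain ⟨sA, hwin⟩ := ESO_spec m (k + 1)
    obtain ⟨N, hN⟩ := Nat.exists_eq_add_one.2 (ESO_pos (m := m) (k := k + 1) (by omega) (by omega))
    rw [hN] at hwin ⊢
    exact Nat.lt_succ_of_le (Nat.sInf_le ⟨sA, hwin.of_succ_down hm⟩)
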